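/- Every 5-regular graph G and every set F ⊆ {0,1,…,5} with |F| ≤ 2 admits an F-avoiding orientation, i.e., an orientation in which no vertex has out-degree belonging to F. -/

import Mathlib

attribute [local instance] Classical.propDecidable

/-- A loopless multigraph: edges indexed by `E` with endpoints in `Sym2 V`. -/
structure Multigraph (V E : Type) where
  ends : E → Sym2 V
  loopless : ∀ e, ¬ (ends e).IsDiag

namespace Multigraph

variable {V E : Type}

/-- Degree of a vertex: number of edges incident to it. -/
noncomputable def deg [Fintype E] (G : Multigraph V E) (v : V) : ℕ :=
  (Finset.univ.filter fun e => v ∈ G.ends e).card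

/-- Two vertices are adjacent if some edge joins them. -/
def Adj (G : Multigraph V E) (u v : V) : Prop :=
  u ≠ v ∧ ∃ e, G.ends e = s(u, v)

/-- An orientation assigns a tail and head to each edge, consistent with its endpoints. -/
structure Orientation (G : Multigraph V E) where
  tail : E → V
  head : E → V
  consistent : ∀ e, G.ends e = s(tail e, head e)

/-- Out-degree of a vertex in an orientation. -/
noncomputable def Orientation.outDeg [Fintype E] {G : Multigraph V E} (D : G.Orientation)
    (v : V) : ℕ :=
  (Finset.univ.filter fun e => D.tail e = v).card

/-- An orientation is `F`-avoiding if no vertex has out-degree in its forbidden list. -/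
def Orientation.Avoids [Fintype E] {G : Multigraph V E} (D : G.Orientation)
    (F : V → Finset ℕ) : Prop :=
  ∀ v, D.outDeg v ∉ F v

/-- Number of edges with both endpoints in `S`. -/
noncomputable def eIn [Fintype E] (G : Multigraph V E) (S : Finset V) : ℕ :=
  (Finset.univ.filter fun e => ∀ w ∈ G.ends e, w ∈ S).card

/-- Number of edges with exactly one endpoint in `S`. -/
noncomputable def cut [Fintype E] (G : Multigraph V E) (S : Finset V) : ℕ :=
  (Finset.univ.filter fun e => (∃ w ∈ G.ends e, w ∈ S) ∧ ¬ ∀ w ∈ G.ends e, w ∈ S).card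

/-- Reachability by directed paths in an orientation. -/
def Orientation.Reach {G : Multigraph V E} (D : G.Orientation) : V → V → Prop :=
  Relation.ReflTransGen fun a b => ∃ e, D.tail e = a ∧ D.head e = b

end Multigraph

namespace Multigraph

variable {V E : Type} {G : Multigraph V E}

theorem exists_minimal_measure {α : Type} (P : α → Prop) (f : α → ℕ) (h : ∃ a, P a) :
    ∃ a, P a ∧ ∀ b, P b → f a ≤ f b := by
  obtain ⟨a, ha, hmin⟩ := WellFounded.has_min (measure f).wf {a | P a} h
  exact ⟨a, ha, fun b hb => not_lt.mp (hmin b hb)⟩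

theorem exists_orientation (G : Multigraph V E) : Nonempty G.Orientation := by
  have h : ∀ e, ∃ p : V × V, G.ends e = s(p.1, p.2) := fun e => by
    induction G.ends e with
    | h a b => exact ⟨(a, b), rfl⟩
  choose p hp using h
  exact ⟨⟨fun e => (p e).1, fun e => (p e).2, hp⟩⟩

theorem sum_card_fiber [Fintype E] (f : E → V) (P : E → Prop) [DecidablePred P] (S : Finset V) :
    ∑ v ∈ S, (Finset.univ.filter fun e => f e = v ∧ P e).card =
      (Finset.univ.filter fun e => f e ∈ S ∧ P e).card := by
  rw [Finset.card_eq_sum_card_fiberwise (f := f) (t := S) (by intro e; simp; tauto)]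
  refine Finset.sum_congr rfl fun v hv => ?_
  congr 1
  ext e
  simp only [Finset.mem_filter, Finset.mem_univ, true_and]
  exact ⟨fun h => ⟨⟨h.1 ▸ hv, h.2⟩, h.1⟩, fun h => ⟨h.2, h.1.2⟩⟩

namespace Orientation

/-- The orientation with every edge reversed. -/
def reverse (D : G.Orientation) : G.Orientation where
  tail := D.head
  head := D.tail
  consistent e := by rw [D.consistent e, Sym2.eq_swap]

/-- The orientation with the single edge `e₀` reversed. -/
noncomputable def flip (D : G.Orientation) (e₀ : E) : G.Orientation where
  tail e := if e = e₀ then D.head e else D.tail e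
  head e := if e = e₀ then D.tail e else D.head e
  consistent e := by
    split_ifs
    · rw [D.consistent e, Sym2.eq_swap]
    · exact D.consistent e

/-- In-degree of a vertex in an orientation. -/
noncomputable def inDeg [Fintype E] (D : G.Orientation) (v : V) : ℕ :=
  (Finset.univ.filter fun e => D.head e = v).card

theorem tail_ne_head (D : G.Orientation) (e : E) : D.tail e ≠ D.head e := by
  intro h
  apply G.loopless e
  rw [D.consistent e, h]
  exact Sym2.mk_isDiag_iff.mpr rfl

theorem mem_ends_iff (D : G.Orientation) (e : E) (v : V) :
    v ∈ G.ends e ↔ D.tail e = v ∨ D.head e = v := by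
  rw [D.consistent e, Sym2.mem_iff]
  tauto

theorem head_eq_of_tail_eq (D D' : G.Orientation) {e : E} (h : D'.tail e = D.tail e) :
    D'.head e = D.head e := by
  have := (D'.consistent e).symm.trans (D.consistent e)
  rw [h] at this
  exact Sym2.congr_right.mp this

theorem outDeg_add_inDeg [Fintype E] (D : G.Orientation) (v : V) :
    D.outDeg v + D.inDeg v = G.deg v := by
  unfold outDeg inDeg deg
  rw [← Finset.card_union_of_disjoint]
  · congr 1
    ext e
    simp [D.mem_ends_iff e v]
  · rw [Finset.disjoint_filter]
    intro e _ h1 h2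
    exact D.tail_ne_head e (h1.trans h2.symm)

theorem outDeg_flip [Fintype E] (D : G.Orientation) (e₀ : E) (x : V) :
    (D.flip e₀).outDeg x + (if x = D.tail e₀ then 1 else 0) =
      D.outDeg x + (if x = D.head e₀ then 1 else 0) := by
  unfold outDeg
  simp only [Finset.card_filter]
  rw [← Finset.add_sum_erase _ _ (Finset.mem_univ e₀),
    ← Finset.add_sum_erase Finset.univ (fun e => if D.tail e = x then 1 else 0)
      (Finset.mem_univ e₀)]
  have : ∑ e ∈ Finset.univ.erase e₀, (if (D.flip e₀).tail e = x then 1 else 0) =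
      ∑ e ∈ Finset.univ.erase e₀, (if D.tail e = x then 1 else 0) := by
    refine Finset.sum_congr rfl fun e he => ?_
    simp [flip, Finset.ne_of_mem_erase he]
  rw [this]
  simp only [flip, if_true, eq_comm (a := x)]
  omega

theorem sum_outDeg [Fintype E] (D : G.Orientation) (S : Finset V) :
    ∑ v ∈ S, D.outDeg v = (Finset.univ.filter fun e => D.tail e ∈ S).card := by
  simpa [outDeg] using sum_card_fiber D.tail (fun _ => True) S

theorem sum_inDeg [Fintype E] (D : G.Orientation) (S : Finset V) :
    ∑ v ∈ S, D.inDeg v = (Finset.univ.filter fun e => D.head e ∈ S).card :=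
  D.reverse.sum_outDeg S

/-- Vertices reachable from `u` by a directed walk of length at most `n`. -/
def ball (D : G.Orientation) (u : V) : ℕ → Set V
  | 0 => {u}
  | n + 1 => {v | v ∈ D.ball u n ∨ ∃ e, D.tail e ∈ D.ball u n ∧ D.head e = v}

/-- Reversing a shortest directed walk from `u` to `v` moves one unit of out-degree from `u` to `v`
and touches at most one edge entering `v`. -/
theorem exists_reverse_walk [Fintype E] (D : G.Orientation) (u : V) (n : ℕ) :
    ∀ v ∈ D.ball u n, ∃ D' : G.Orientation,
      (∀ x, D'.outDeg x + (if x = u then 1 else 0) = D.outDeg x + (if x = v then 1 else 0)) ∧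
      (∀ e, D'.tail e ≠ D.tail e → D.head e ∈ D.ball u n) ∧
      (∀ e f, D.head e = v → D.head f = v → D'.tail e ≠ D.tail e → D'.tail f ≠ D.tail f →
        e = f) := by
  induction n with
  | zero =>
    intro v hv
    obtain rfl : v = u := hv
    exact ⟨D, fun _ => rfl, fun e he => absurd rfl he, fun e f _ _ he => absurd rfl he⟩
  | succ n ih =>
    intro v hv
    by_cases hvn : v ∈ D.ball u n
    · obtain ⟨D', h1, h2, h3⟩ := ih v hvn
      exact ⟨D', h1, fun e he => Or.inl (h2 e he), h3⟩
    obtain hv | ⟨e₀, he₀, hev⟩ := hv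
    · exact absurd hv hvn
    obtain ⟨D', h1, h2, -⟩ := ih _ he₀
    have ht : D'.tail e₀ = D.tail e₀ := by
      by_contra h
      exact hvn (hev ▸ h2 e₀ h)
    have hh : D'.head e₀ = v := (head_eq_of_tail_eq D D' ht).trans hev
    have key : ∀ e, (D'.flip e₀).tail e ≠ D.tail e → e = e₀ ∨ D.head e ∈ D.ball u n := by
      intro e he
      by_cases hee : e = e₀
      · exact Or.inl hee
      · refine Or.inr (h2 e ?_)
        simpa [flip, hee] using he
    refine ⟨D'.flip e₀, fun x => ?_, fun e he => ?_, fun e f hev' hfv he hf => ?_⟩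
    · have a1 := h1 x
      have a2 := D'.outDeg_flip e₀ x
      rw [ht, hh] at a2
      omega
    · obtain rfl | h := key e he
      · exact Or.inr ⟨e, he₀, rfl⟩
      · exact Or.inl h
    · obtain rfl | h := key e he
      · obtain rfl | h' := key f hf
        · rfl
        · exact absurd (hfv ▸ h') hvn
      · exact absurd (hev' ▸ h) hvn

/-- Vertices reachable from `u` by a directed walk. -/
noncomputable def reachSet [Fintype V] (D : G.Orientation) (u : V) : Finset V :=
  Finset.univ.filter fun v => ∃ n, v ∈ D.ball u n

theorem self_mem_reachSet [Fintype V] (D : G.Orientation) (u : V) : u ∈ D.reachSet u := by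
  simp only [reachSet, Finset.mem_filter, Finset.mem_univ, true_and]
  exact ⟨0, rfl⟩

theorem head_mem_reachSet [Fintype V] (D : G.Orientation) {u : V} {e : E}
    (h : D.tail e ∈ D.reachSet u) : D.head e ∈ D.reachSet u := by
  simp only [reachSet, Finset.mem_filter, Finset.mem_univ, true_and] at h ⊢
  obtain ⟨n, hn⟩ := h
  exact ⟨n + 1, Or.inr ⟨e, hn, rfl⟩⟩

theorem exists_reverse_path [Fintype V] [Fintype E] (D : G.Orientation) {u v : V}
    (h : v ∈ D.reachSet u) : ∃ D' : G.Orientation,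
      (∀ x, D'.outDeg x + (if x = u then 1 else 0) = D.outDeg x + (if x = v then 1 else 0)) ∧
      (∀ e f, D.head e = v → D.head f = v → D'.tail e ≠ D.tail e → D'.tail f ≠ D.tail f →
        e = f) := by
  simp only [reachSet, Finset.mem_filter, Finset.mem_univ, true_and] at h
  obtain ⟨n, hn⟩ := h
  obtain ⟨D', h1, -, h3⟩ := D.exists_reverse_walk u n v hn
  exact ⟨D', h1, h3⟩

/-- If two edges enter `v` from vertices `x₁, x₂`, then besides reversing a walk from `u` to `v`
one of these two edges can be reversed as well. -/
theorem exists_reverse_path_and_edge [Fintype V] [Fintype E] (D : G.Orientation) {u v : V}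
    (h : v ∈ D.reachSet u) {e f : E} (hef : e ≠ f) (he : D.head e = v) (hf : D.head f = v) :
    ∃ D' : G.Orientation, ∃ g, (g = e ∨ g = f) ∧
      ∀ x, D'.outDeg x + (if x = u then 1 else 0) + (if x = D.tail g then 1 else 0) =
        D.outDeg x + 2 * (if x = v then 1 else 0) := by
  obtain ⟨D', h1, h2⟩ := D.exists_reverse_path h
  obtain ⟨g, hg, hgt⟩ : ∃ g, (g = e ∨ g = f) ∧ D'.tail g = D.tail g := by
    by_contra! hc
    exact hef (h2 e f he hf (hc e (Or.inl rfl)) (hc f (Or.inr rfl)))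
  have hgv : D.head g = v := by
    obtain rfl | rfl := hg
    · exact he
    · exact hf
  refine ⟨D'.flip g, g, hg, fun x => ?_⟩
  have a1 := h1 x
  have a2 := D'.outDeg_flip g x
  rw [hgt, head_eq_of_tail_eq D D' hgt, hgv] at a2
  omega

end Orientation

/-- A vertex whose out-degree exceeds its in-degree by two reaches a vertex whose in-degree
exceeds its out-degree. -/
theorem Orientation.exists_better_of_excess [Fintype V] [Fintype E] (D : G.Orientation) {u : V}
    (hu : D.inDeg u + 2 ≤ D.outDeg u) : ∃ D' : G.Orientation,
      ∑ x, (D'.outDeg x ^ 2 + D'.inDeg x ^ 2) < ∑ x, (D.outDeg x ^ 2 + D.inDeg x ^ 2) := by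
  obtain ⟨v, hv, hlt⟩ : ∃ v ∈ D.reachSet u, D.outDeg v < D.inDeg v := by
    by_contra! hc
    have h1 : ∑ v ∈ D.reachSet u, D.inDeg v < ∑ v ∈ D.reachSet u, D.outDeg v :=
      Finset.sum_lt_sum hc ⟨u, D.self_mem_reachSet u, by omega⟩
    rw [D.sum_inDeg, D.sum_outDeg] at h1
    refine absurd (Finset.card_le_card ?_) (not_le.mpr h1)
    intro e
    simp only [Finset.mem_filter, Finset.mem_univ, true_and]
    exact D.head_mem_reachSet
  obtain ⟨D', h1, -⟩ := D.exists_reverse_path hv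
  have hne : u ≠ v := by rintro rfl; omega
  have hd : ∀ x, D'.outDeg x + D'.inDeg x = D.outDeg x + D.inDeg x := fun x =>
    (D'.outDeg_add_inDeg x).trans (D.outDeg_add_inDeg x).symm
  refine ⟨D', Finset.sum_lt_sum (fun x _ => ?_) ⟨u, Finset.mem_univ u, ?_⟩⟩
  · have a := h1 x
    have b := hd x
    by_cases hxu : x = u
    · subst hxu
      simp only [if_true, if_neg hne] at a
      have e1 : D.outDeg x = D'.outDeg x + 1 := by omega
      have e2 : D'.inDeg x = D.inDeg x + 1 := by omega
      rw [e1, e2]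
      rw [e1] at hu
      nlinarith
    · by_cases hxv : x = v
      · subst hxv
        simp only [if_true, if_neg hxu] at a
        have e1 : D'.outDeg x = D.outDeg x + 1 := by omega
        have e2 : D.inDeg x = D'.inDeg x + 1 := by omega
        rw [e1, e2]
        rw [e2] at hlt
        nlinarith
      · simp only [if_neg hxu, if_neg hxv] at a
        have e1 : D'.outDeg x = D.outDeg x := by omega
        have e2 : D'.inDeg x = D.inDeg x := by omega
        rw [e1, e2]
  · have a := h1 u
    have b := hd u
    simp only [if_true, if_neg hne] at a
    have e1 : D.outDeg u = D'.outDeg u + 1 := by omega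
    have e2 : D'.inDeg u = D.inDeg u + 1 := by omega
    rw [e1, e2]
    rw [e1] at hu
    nlinarith

/-- Every multigraph has an orientation in which in- and out-degrees differ by at most one. -/
theorem exists_balanced [Fintype V] [Fintype E] (G : Multigraph V E) :
    ∃ D : G.Orientation, ∀ v, D.outDeg v ≤ D.inDeg v + 1 ∧ D.inDeg v ≤ D.outDeg v + 1 := by
  obtain ⟨D₀⟩ := G.exists_orientation
  obtain ⟨D, -, hmin⟩ := exists_minimal_measure (fun _ : G.Orientation => True)
    (fun D => ∑ x, (D.outDeg x ^ 2 + D.inDeg x ^ 2)) ⟨D₀, trivial⟩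
  refine ⟨D, fun v => ⟨?_, ?_⟩⟩
  · by_contra h
    obtain ⟨D', hD'⟩ := D.exists_better_of_excess (u := v) (by omega)
    exact absurd (hmin D' trivial) (not_le.mpr hD')
  · by_contra h
    have h' : D.reverse.inDeg v + 2 ≤ D.reverse.outDeg v := by
      change D.outDeg v + 2 ≤ D.inDeg v
      omega
    obtain ⟨D', hD'⟩ := D.reverse.exists_better_of_excess h'
    refine absurd (hmin D' trivial) (not_le.mpr (hD'.trans_eq ?_))
    exact Finset.sum_congr rfl fun x _ => Nat.add_comm _ _

/-- Given a set `S` of vertices, orient all edges across from `S` to its complement and the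
others in a balanced way. -/
theorem exists_cut_orientation [Fintype V] [Fintype E] (G : Multigraph V E) (S : V → Prop) :
    ∃ D : G.Orientation, ∀ v,
      (S v → 2 * D.inDeg v ≤
        (Finset.univ.filter fun e => v ∈ G.ends e ∧ ∀ w ∈ G.ends e, S w ↔ S v).card + 1) ∧
      (¬ S v → 2 * D.outDeg v ≤
        (Finset.univ.filter fun e => v ∈ G.ends e ∧ ∀ w ∈ G.ends e, S w ↔ S v).card + 1) := by
  let M : E → Prop := fun e => ∀ a ∈ G.ends e, ∀ b ∈ G.ends e, S a ↔ S b
  let H : Multigraph V {e // M e} := ⟨fun e => G.ends e, fun e => G.loopless e⟩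
  obtain ⟨B, hB⟩ := H.exists_balanced
  obtain ⟨D₀⟩ := G.exists_orientation
  have h : ∀ e, ∃ p : V × V, G.ends e = s(p.1, p.2) ∧
      (∀ h : M e, p = (B.tail ⟨e, h⟩, B.head ⟨e, h⟩)) ∧ (¬ M e → S p.1 ∧ ¬ S p.2) := by
    intro e
    by_cases hM : M e
    · exact ⟨(B.tail ⟨e, hM⟩, B.head ⟨e, hM⟩), B.consistent ⟨e, hM⟩, fun _ => rfl,
        fun h => absurd hM h⟩
    · by_cases ht : S (D₀.tail e)
      · refine ⟨(D₀.tail e, D₀.head e), D₀.consistent e, fun h => absurd h hM,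
          fun _ => ⟨ht, fun hh => hM ?_⟩⟩
        intro a ha b hb
        rw [D₀.mem_ends_iff] at ha hb
        rcases ha with rfl | rfl <;> rcases hb with rfl | rfl <;> tauto
      · refine ⟨(D₀.head e, D₀.tail e), D₀.reverse.consistent e, fun h => absurd h hM,
          fun _ => ⟨by_contra fun hh => hM ?_, ht⟩⟩
        intro a ha b hb
        rw [D₀.mem_ends_iff] at ha hb
        rcases ha with rfl | rfl <;> rcases hb with rfl | rfl <;> tauto
  choose p hp1 hp2 hp3 using h
  let D : G.Orientation := ⟨fun e => (p e).1, fun e => (p e).2, hp1⟩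
  have hdeg : ∀ v, H.deg v ≤
      (Finset.univ.filter fun e => v ∈ G.ends e ∧ ∀ w ∈ G.ends e, S w ↔ S v).card := by
    intro v
    refine Finset.card_le_card_of_injOn Subtype.val ?_ Subtype.val_injective.injOn
    rintro ⟨e, he⟩ h
    simp only [Finset.coe_filter, Finset.mem_univ, true_and, Set.mem_ofPred_eq] at h ⊢
    exact ⟨h, fun w hw => he w hw v h⟩
  refine ⟨D, fun v => ⟨fun hv => ?_, fun hv => ?_⟩⟩
  · have h1 : D.inDeg v ≤ B.inDeg v := by
      have hM : ∀ e, D.head e = v → M e := fun e he =>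
        by_contra fun h => (hp3 e h).2 (by rw [← he] at hv; exact hv)
      refine (Finset.card_le_card (t := (Finset.univ.filter fun i => B.head i = v).image
        Subtype.val) ?_).trans Finset.card_image_le
      intro e he
      simp only [Finset.mem_filter, Finset.mem_univ, true_and] at he
      refine Finset.mem_image.mpr ⟨⟨e, hM e he⟩, ?_, rfl⟩
      simp only [Finset.mem_filter, Finset.mem_univ, true_and]
      rw [← he]
      exact (congrArg Prod.snd (hp2 e (hM e he))).symm
    have h2 := B.outDeg_add_inDeg v
    have h3 := hdeg v
    have h4 := hB v
    omega
  · have h1 : D.outDeg v ≤ B.outDeg v := by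
      have hM : ∀ e, D.tail e = v → M e := fun e he =>
        by_contra fun h => hv (by rw [← he]; exact (hp3 e h).1)
      refine (Finset.card_le_card (t := (Finset.univ.filter fun i => B.tail i = v).image
        Subtype.val) ?_).trans Finset.card_image_le
      intro e he
      simp only [Finset.mem_filter, Finset.mem_univ, true_and] at he
      refine Finset.mem_image.mpr ⟨⟨e, hM e he⟩, ?_, rfl⟩
      simp only [Finset.mem_filter, Finset.mem_univ, true_and]
      rw [← he]
      exact (congrArg Prod.fst (hp2 e (hM e he))).symm
    have h2 := B.outDeg_add_inDeg v
    have h3 := hdeg v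
    have h4 := hB v
    omega

/-- In a 5-regular multigraph, there is an orientation with out-degrees at most `4` whose set of
vertices of out-degree `k` cannot be shrunk. -/
theorem exists_minimal_outDeg_eq [Fintype V] [Fintype E] (hreg : ∀ v, G.deg v = 5) (k : ℕ) :
    ∃ D : G.Orientation, (∀ v, D.outDeg v ≤ 4) ∧ ∀ D' : G.Orientation, (∀ v, D'.outDeg v ≤ 4) →
      (∀ v, D'.outDeg v = k → D.outDeg v = k) → ∀ u, D.outDeg u = k → D'.outDeg u = k := by
  have h0 : ∃ D : G.Orientation, ∀ v, D.outDeg v ≤ 4 := by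
    obtain ⟨B, hB⟩ := G.exists_balanced
    refine ⟨B, fun v => ?_⟩
    have h1 := hB v
    have h2 := B.outDeg_add_inDeg v
    rw [hreg] at h2
    omega
  obtain ⟨D, hD, hmin⟩ := exists_minimal_measure (fun D : G.Orientation => ∀ v, D.outDeg v ≤ 4)
    (fun D => (Finset.univ.filter fun v => D.outDeg v = k).card) h0
  refine ⟨D, hD, fun D' hD' hsub u hu => by_contra fun hu' => ?_⟩
  refine absurd (hmin D' hD') (not_le.mpr (Finset.card_lt_card ?_))
  rw [Finset.ssubset_iff_of_subset]
  · exact ⟨u, by simpa using hu, by simpa using hu'⟩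
  · intro v
    simpa using hsub v

theorem exists_outDeg_ne_two_five [Fintype V] [Fintype E] (hreg : ∀ v, G.deg v = 5) :
    ∃ D : G.Orientation, ∀ v, D.outDeg v ≠ 2 ∧ D.outDeg v ≠ 5 := by
  obtain ⟨D, hD, hmin⟩ := exists_minimal_outDeg_eq hreg 2
  refine ⟨D, fun u => ⟨fun hu => ?_, fun h => by have := hD u; omega⟩⟩
  have hR : ∀ v ∈ D.reachSet u, v ≠ u → D.outDeg v = 1 ∨ D.outDeg v = 4 := by
    intro v hv hvu
    by_contra hc
    obtain ⟨D', h1, -⟩ := D.exists_reverse_path hv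
    have key : ∀ x, D'.outDeg x ≤ 4 ∧ (D'.outDeg x = 2 → D.outDeg x = 2) := by
      intro x
      have a := h1 x
      have b := hD x
      by_cases hxu : x = u
      · subst hxu
        simp only [if_true, if_neg (Ne.symm hvu)] at a
        omega
      · by_cases hxv : x = v
        · subst hxv
          simp only [if_true, if_neg hxu] at a
          omega
        · simp only [if_neg hxu, if_neg hxv] at a
          omega
    have a := h1 u
    have b := hmin D' (fun x => (key x).1) (fun x => (key x).2) u hu
    simp only [if_true, if_neg (Ne.symm hvu)] at a
    omega
  have hone : ∀ v ∈ D.reachSet u, v ≠ u → D.outDeg v = 1 → ∀ e f, D.head e = v →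
      D.tail e ∈ D.reachSet u → D.head f = v → D.tail f ∈ D.reachSet u → e = f := by
    intro v hv hvu hv1 e f he het hf hft
    by_contra hef
    obtain ⟨D', g, hg, h1⟩ := D.exists_reverse_path_and_edge hv hef he hf
    have hgt : D.tail g ∈ D.reachSet u := by
      obtain rfl | rfl := hg
      · exact het
      · exact hft
    have hgv : D.tail g ≠ v := by
      intro h
      refine D.tail_ne_head g (h.trans ?_)
      obtain rfl | rfl := hg
      · exact he.symm
      · exact hf.symm
    have key : ∀ x, D'.outDeg x ≤ 4 ∧ (D'.outDeg x = 2 → D.outDeg x = 2) := by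
      intro x
      have a := h1 x
      have b := hD x
      have c := hR _ hgt
      grind
    have a := h1 u
    have b := hmin D' (fun x => (key x).1) (fun x => (key x).2) u hu
    simp only [if_true, if_neg (Ne.symm hvu)] at a
    omega
  have hzero : ∀ e, D.head e = u → D.tail e ∉ D.reachSet u := by
    intro e he het
    have hne : D.tail e ≠ u := he ▸ D.tail_ne_head e
    have c := hR _ het hne
    have h1 := D.outDeg_flip e
    rw [he] at h1
    have key : ∀ x, (D.flip e).outDeg x ≤ 4 ∧ ((D.flip e).outDeg x = 2 → D.outDeg x = 2) := by
      intro x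
      have a := h1 x
      have b := hD x
      grind
    have a := h1 u
    have b := hmin _ (fun x => (key x).1) (fun x => (key x).2) u hu
    simp only [if_true, if_neg (Ne.symm hne)] at a
    omega
  have hlt : ∑ v ∈ D.reachSet u,
      (Finset.univ.filter fun e => D.head e = v ∧ D.tail e ∈ D.reachSet u).card <
        ∑ v ∈ D.reachSet u, D.outDeg v := by
    refine Finset.sum_lt_sum (fun v hv => ?_) ⟨u, D.self_mem_reachSet u, ?_⟩
    · by_cases hvu : v = u
      · subst hvu
        rw [Finset.card_eq_zero.mpr]
        · exact Nat.zero_le _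
        · exact Finset.filter_eq_empty_iff.mpr fun e _ h => hzero e h.1 h.2
      · obtain h | h := hR v hv hvu
        · rw [h, Finset.card_le_one]
          simp only [Finset.mem_filter, Finset.mem_univ, true_and]
          exact fun e he f hf => hone v hv hvu h e f he.1 he.2 hf.1 hf.2
        · have a := D.outDeg_add_inDeg v
          rw [hreg] at a
          have b : (Finset.univ.filter fun e => D.head e = v ∧ D.tail e ∈ D.reachSet u).card ≤
              D.inDeg v := Finset.card_le_card fun e => by simp; tauto
          omega
    · rw [Finset.card_eq_zero.mpr, hu]
      · exact Nat.two_pos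
      · exact Finset.filter_eq_empty_iff.mpr fun e _ h => hzero e h.1 h.2
  rw [sum_card_fiber, D.sum_outDeg] at hlt
  refine absurd (Finset.card_le_card fun e => ?_) (not_le.mpr hlt)
  simp only [Finset.mem_filter, Finset.mem_univ, true_and]
  exact fun h => ⟨D.head_mem_reachSet h, h⟩

theorem exists_outDeg_ne_three_five [Fintype V] [Fintype E] (hreg : ∀ v, G.deg v = 5) :
    ∃ D : G.Orientation, ∀ v, D.outDeg v ≠ 3 ∧ D.outDeg v ≠ 5 := by
  obtain ⟨D, hD, hmin⟩ := exists_minimal_outDeg_eq hreg 3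
  refine ⟨D, fun u => ⟨fun hu => ?_, fun h => by have := hD u; omega⟩⟩
  have hR : ∀ v ∈ D.reachSet u, v ≠ u → D.outDeg v = 2 ∨ D.outDeg v = 4 := by
    intro v hv hvu
    by_contra hc
    obtain ⟨D', h1, -⟩ := D.exists_reverse_path hv
    have key : ∀ x, D'.outDeg x ≤ 4 ∧ (D'.outDeg x = 3 → D.outDeg x = 3) := by
      intro x
      have a := h1 x
      have b := hD x
      grind
    have a := h1 u
    have b := hmin D' (fun x => (key x).1) (fun x => (key x).2) u hu
    simp only [if_true, if_neg (Ne.symm hvu)] at a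
    omega
  let Z := (D.reachSet u).filter fun v => D.outDeg v ≠ 4
  have htwo : ∀ v ∈ D.reachSet u, v ≠ u → D.outDeg v = 2 → ∀ e f, D.head e = v →
      D.tail e ∈ Z → D.head f = v → D.tail f ∈ Z → e = f := by
    intro v hv hvu hv2 e f he het hf hft
    by_contra hef
    obtain ⟨D', g, hg, h1⟩ := D.exists_reverse_path_and_edge hv hef he hf
    have hgt : D.tail g ∈ Z := by
      obtain rfl | rfl := hg
      · exact het
      · exact hft
    have hgv : D.tail g ≠ v := by
      intro h
      refine D.tail_ne_head g (h.trans ?_)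
      obtain rfl | rfl := hg
      · exact he.symm
      · exact hf.symm
    have key : ∀ x, D'.outDeg x ≤ 4 ∧ (D'.outDeg x = 3 → D.outDeg x = 3) := by
      intro x
      have a := h1 x
      have b := hD x
      have c := hR _ (Finset.mem_filter.mp hgt).1
      have d := (Finset.mem_filter.mp hgt).2
      grind
    have a := h1 u
    have b := hmin D' (fun x => (key x).1) (fun x => (key x).2) u hu
    simp only [if_true, if_neg (Ne.symm hvu)] at a
    omega
  have hin : ∀ v, (Finset.univ.filter fun e => D.head e = v ∧ D.tail e ∈ Z).card ≤ D.inDeg v :=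
    fun v => Finset.card_le_card fun e => by simp; tauto
  have hlt : ∑ v ∈ D.reachSet u,
      (D.inDeg v + (Finset.univ.filter fun e => D.head e = v ∧ D.tail e ∈ Z).card) <
        ∑ v ∈ D.reachSet u, (D.outDeg v + if D.outDeg v ≠ 4 then D.outDeg v else 0) := by
    have hstrict : D.inDeg u + (Finset.univ.filter fun e => D.head e = u ∧ D.tail e ∈ Z).card <
        D.outDeg u + if D.outDeg u ≠ 4 then D.outDeg u else 0 := by
      have a := D.outDeg_add_inDeg u
      rw [hreg] at a
      have b := hin u
      rw [if_pos (by omega)]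
      omega
    refine Finset.sum_lt_sum (fun v hv => ?_) ⟨u, D.self_mem_reachSet u, hstrict⟩
    by_cases hvu : v = u
    · rw [hvu]
      exact hstrict.le
    · have a := D.outDeg_add_inDeg v
      rw [hreg] at a
      have b := hin v
      obtain h | h := hR v hv hvu
      · have c : (Finset.univ.filter fun e => D.head e = v ∧ D.tail e ∈ Z).card ≤ 1 := by
          rw [Finset.card_le_one]
          simp only [Finset.mem_filter, Finset.mem_univ, true_and]
          exact fun e he f hf => htwo v hv hvu h e f he.1 he.2 hf.1 hf.2
        rw [if_pos (by omega)]
        omega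
      · omega
  rw [Finset.sum_add_distrib, Finset.sum_add_distrib, sum_card_fiber, D.sum_outDeg, D.sum_inDeg,
    ← Finset.sum_filter, D.sum_outDeg] at hlt
  refine absurd (Nat.add_le_add (Finset.card_le_card fun e => ?_)
    (Finset.card_le_card fun e => ?_)) (not_le.mpr hlt)
  · simp only [Finset.mem_filter, Finset.mem_univ, true_and]
    exact D.head_mem_reachSet
  · simp only [Finset.mem_filter, Finset.mem_univ, true_and]
    exact fun h => ⟨D.head_mem_reachSet h.1, Finset.mem_filter.mpr h⟩

theorem exists_outDeg_ne_two_three [Fintype V] [Fintype E] (hreg : ∀ v, G.deg v = 5) :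
    ∃ D : G.Orientation, ∀ v, D.outDeg v ≠ 2 ∧ D.outDeg v ≠ 3 := by
  obtain ⟨S, -, hS⟩ := exists_minimal_measure (fun _ : V → Prop => True)
    (fun S => (Finset.univ.filter fun e => ∀ a ∈ G.ends e, ∀ b ∈ G.ends e, S a ↔ S b).card)
    ⟨fun _ => True, trivial⟩
  have hcard : ∀ v,
      (Finset.univ.filter fun e => v ∈ G.ends e ∧ ∀ w ∈ G.ends e, S w ↔ S v).card ≤ 2 := by
    intro v
    obtain ⟨D₀⟩ := G.exists_orientation
    have h := hS (Function.update S v (¬ S v)) trivial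
    have hd := hreg v
    unfold deg at hd
    simp only [Finset.card_filter] at h hd ⊢
    have : ∑ e, (if ∀ a ∈ G.ends e, ∀ b ∈ G.ends e,
          Function.update S v (¬ S v) a ↔ Function.update S v (¬ S v) b then 1 else 0) +
        2 * ∑ e, (if v ∈ G.ends e ∧ ∀ w ∈ G.ends e, S w ↔ S v then 1 else 0) ≤
        ∑ e, (if ∀ a ∈ G.ends e, ∀ b ∈ G.ends e, S a ↔ S b then 1 else 0) +
        ∑ e, (if v ∈ G.ends e then 1 else 0) := by
      rw [Finset.mul_sum, ← Finset.sum_add_distrib, ← Finset.sum_add_distrib]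
      refine Finset.sum_le_sum fun e _ => ?_
      have hne := D₀.tail_ne_head e
      rw [D₀.consistent e]
      simp only [Sym2.mem_iff, forall_eq_or_imp, forall_eq]
      generalize D₀.tail e = x at *
      generalize D₀.head e = y at *
      by_cases hx : x = v
      · subst hx
        simp only [Function.update_self, Function.update_of_ne hne.symm]
        by_cases h1 : S x <;> by_cases h2 : S y <;> simp [h1, h2]
      · by_cases hy : y = v
        · subst hy
          simp only [Function.update_self, Function.update_of_ne hx]
          by_cases h1 : S x <;> by_cases h2 : S y <;> simp [h1, h2]
        · simp only [Function.update_of_ne hx, Function.update_of_ne hy]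
          simp [Ne.symm hx, Ne.symm hy]
    omega
  obtain ⟨D, hD⟩ := G.exists_cut_orientation S
  refine ⟨D, fun v => ?_⟩
  have a := D.outDeg_add_inDeg v
  rw [hreg] at a
  have b := hcard v
  have c := hD v
  by_cases hv : S v
  · have := c.1 hv
    omega
  · have := c.2 hv
    omega

theorem exists_outDeg_ne_one_two [Fintype V] [Fintype E] (hreg : ∀ v, G.deg v = 5) :
    ∃ D : G.Orientation, ∀ v, D.outDeg v ≠ 1 ∧ D.outDeg v ≠ 2 := by
  obtain ⟨B, hB, hmin⟩ := exists_minimal_measure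
    (fun B : Finset V => ∀ e, ¬ ∀ w ∈ G.ends e, w ∈ B) (fun B => Bᶜ.card)
    ⟨∅, fun e h => by
      obtain ⟨D₀⟩ := G.exists_orientation
      exact absurd (h _ ((D₀.mem_ends_iff e _).mpr (Or.inl rfl))) (Finset.notMem_empty _)⟩
  obtain ⟨S, hS⟩ : ∃ S : V → Prop, ∀ v, S v ↔ v ∉ B := ⟨_, fun _ => Iff.rfl⟩
  obtain ⟨D, hD⟩ := G.exists_cut_orientation S
  refine ⟨D, fun v => ?_⟩
  have a := D.outDeg_add_inDeg v
  rw [hreg] at a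
  have c := hD v
  by_cases hv : v ∈ B
  · have b := c.2 (fun h => (hS v).mp h hv)
    rw [Finset.card_eq_zero.mpr] at b
    · omega
    · refine Finset.filter_eq_empty_iff.mpr fun e _ h => hB e fun w hw => ?_
      have := h.2 w hw
      rw [hS, hS] at this
      tauto
  · have b := c.1 ((hS v).mpr hv)
    have hlt : (Finset.univ.filter fun e => v ∈ G.ends e ∧ ∀ w ∈ G.ends e, S w ↔ S v).card <
        G.deg v := by
      refine Finset.card_lt_card ((Finset.ssubset_iff_of_subset ?_).mpr ?_)
      · intro e
        simp only [Finset.mem_filter, Finset.mem_univ, true_and]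
        exact And.left
      · by_contra! hc
        have hind : ∀ e, ¬ ∀ w ∈ G.ends e, w ∈ insert v B := by
          intro e he
          have hve : v ∈ G.ends e := by
            by_contra hve
            refine hB e fun w hw => (Finset.mem_insert.mp (he w hw)).resolve_left ?_
            rintro rfl
            exact hve hw
          have := hc e (by simpa using hve)
          simp only [Finset.mem_filter, Finset.mem_univ, true_and] at this
          have hall : ∀ w ∈ G.ends e, w = v := fun w hw =>
            (Finset.mem_insert.mp (he w hw)).resolve_right
              ((hS w).mp ((this.2 w hw).mpr ((hS v).mpr hv)))
          obtain ⟨D₀⟩ := G.exists_orientation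
          exact D₀.tail_ne_head e ((hall _ ((D₀.mem_ends_iff e _).mpr (Or.inl rfl))).trans
            (hall _ ((D₀.mem_ends_iff e _).mpr (Or.inr rfl))).symm)
        refine absurd (hmin _ hind) (not_le.mpr (Finset.card_lt_card ?_))
        exact Finset.compl_ssubset_compl.mpr (Finset.ssubset_insert hv)
    rw [hreg] at hlt
    omega

theorem Orientation.outDeg_eq_of_unchanged [Fintype E] {D D' : G.Orientation} {S : Set V}
    (h : ∀ e, D'.tail e ≠ D.tail e → ∀ a ∈ G.ends e, a ∈ S) {x : V} (hx : x ∉ S) :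
    D'.outDeg x = D.outDeg x := by
  unfold outDeg
  congr 1
  ext e
  simp only [Finset.mem_filter, Finset.mem_univ, true_and]
  by_cases he : D'.tail e = D.tail e
  · rw [he]
  · refine ⟨fun h' => absurd (h e he x ?_) hx, fun h' => absurd (h e he x ?_) hx⟩
    · exact (D'.mem_ends_iff e x).mpr (Or.inl h')
    · exact (D.mem_ends_iff e x).mpr (Or.inl h')

/-- Reversing the edges of an undirected walk from `x` to `r` inside `S` changes the parity of
the out-degree exactly at `x` and `r`. -/
theorem Orientation.exists_parity_flip [Fintype E] (D : G.Orientation) (S : Set V) {x r : V}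
    (h : Relation.ReflTransGen (fun a b => a ∈ S ∧ b ∈ S ∧ ∃ e, G.ends e = s(a, b)) x r) :
    ∃ D' : G.Orientation, (∀ e, D'.tail e ≠ D.tail e → ∀ a ∈ G.ends e, a ∈ S) ∧
      ∀ y, (D'.outDeg y + (if y = x then 1 else 0) + (if y = r then 1 else 0)) % 2 =
        D.outDeg y % 2 := by
  induction h using Relation.ReflTransGen.head_induction_on with
  | refl =>
    refine ⟨D, fun e he => absurd rfl he, fun y => ?_⟩
    split_ifs <;> omega
  | @head a b hab _ ih =>
    obtain ⟨ha, hb, e, he⟩ := hab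
    obtain ⟨D', h1, h2⟩ := ih
    refine ⟨D'.flip e, fun f hf => ?_, fun y => ?_⟩
    · by_cases hfe : f = e
      · subst hfe
        rw [he]
        intro c hc
        obtain rfl | rfl := Sym2.mem_iff.mp hc
        · exact ha
        · exact hb
      · exact h1 f (by simpa [flip, hfe] using hf)
    · have a1 := h2 y
      have a2 := D'.outDeg_flip e y
      have hc := (D'.consistent e).symm.trans he
      rw [Sym2.eq_iff] at hc
      obtain ⟨h3, h4⟩ | ⟨h3, h4⟩ := hc
      · rw [h3, h4] at a2
        omega
      · rw [h3, h4] at a2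
        omega

/-- If every vertex of `S` is joined to `r` inside `S`, then reorienting edges inside `S` makes
all out-degrees on `S`, except possibly that of `r`, odd. -/
theorem Orientation.exists_odd_on [Fintype V] [Fintype E] (D : G.Orientation) (S : Set V) (r : V)
    (h : ∀ x ∈ S,
      Relation.ReflTransGen (fun a b => a ∈ S ∧ b ∈ S ∧ ∃ e, G.ends e = s(a, b)) x r) :
    ∃ D' : G.Orientation, (∀ e, D'.tail e ≠ D.tail e → ∀ a ∈ G.ends e, a ∈ S) ∧
      ∀ x ∈ S, x ≠ r → D'.outDeg x % 2 = 1 := by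
  obtain ⟨D₁, h1, hmin⟩ := exists_minimal_measure
    (fun D' : G.Orientation => ∀ e, D'.tail e ≠ D.tail e → ∀ a ∈ G.ends e, a ∈ S)
    (fun D' => (Finset.univ.filter fun x => x ∈ S ∧ x ≠ r ∧ D'.outDeg x % 2 = 0).card)
    ⟨D, fun e he => absurd rfl he⟩
  refine ⟨D₁, h1, fun x hx hxr => by_contra fun hodd => ?_⟩
  obtain ⟨D₂, h2, h3⟩ := D₁.exists_parity_flip S (h x hx)
  have h4 : ∀ e, D₂.tail e ≠ D.tail e → ∀ a ∈ G.ends e, a ∈ S := by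
    intro e he
    by_cases h' : D₂.tail e = D₁.tail e
    · exact h1 e (h' ▸ he)
    · exact h2 e h'
  refine absurd (hmin D₂ h4) (not_le.mpr (Finset.card_lt_card ?_))
  rw [Finset.ssubset_iff_of_subset]
  · refine ⟨x, ?_, ?_⟩
    · simp only [Finset.mem_filter, Finset.mem_univ, true_and]
      exact ⟨hx, hxr, by omega⟩
    · simp only [Finset.mem_filter, Finset.mem_univ, true_and]
      have := h3 x
      simp only [if_true, if_neg hxr] at this
      rintro ⟨-, -, h5⟩
      omega
  · intro y
    simp only [Finset.mem_filter, Finset.mem_univ, true_and]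
    rintro ⟨hy, hyr, h5⟩
    have := h3 y
    refine ⟨hy, hyr, ?_⟩
    by_cases hyx : y = x
    · subst hyx
      omega
    · simp only [if_neg hyx, if_neg hyr] at this
      omega

/-- The simple graph of adjacencies of a multigraph. -/
def toSimpleGraph (G : Multigraph V E) : SimpleGraph V where
  Adj := G.Adj
  symm := ⟨fun _ _ h => ⟨h.1.symm, h.2.imp fun _ he => he.trans Sym2.eq_swap⟩⟩
  loopless := ⟨fun _ h => h.1 rfl⟩

theorem reachable_of_mem_ends {u a b : V} {e : E} (ha : a ∈ G.ends e) (hb : b ∈ G.ends e)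
    (h : G.toSimpleGraph.Reachable u a) : G.toSimpleGraph.Reachable u b := by
  by_cases hab : a = b
  · exact hab ▸ h
  · exact h.trans (SimpleGraph.Adj.reachable ⟨hab, e, ((Sym2.mem_and_mem_iff hab).mp ⟨ha, hb⟩)⟩)

theorem reflTransGen_of_reachable {u x : V} (h : G.toSimpleGraph.Reachable u x) :
    Relation.ReflTransGen (fun a b => a ∈ {x | G.toSimpleGraph.Reachable u x} ∧
      b ∈ {x | G.toSimpleGraph.Reachable u x} ∧ ∃ e, G.ends e = s(a, b)) x u := by
  obtain ⟨p⟩ := h.symm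
  induction p with
  | nil => exact Relation.ReflTransGen.refl
  | cons hxy q ih =>
    exact Relation.ReflTransGen.head ⟨h, q.reachable.symm, hxy.2⟩
      (ih q.reachable.symm)

/-- A vertex `u` is joined to each vertex `x` of its component avoiding a vertex `w` not closer to
`u` than `x`. -/
theorem reflTransGen_of_dist_le {u w : V} {S : Set V}
    (hS : ∀ x, G.toSimpleGraph.Reachable u x → x ≠ w → x ∈ S) (huw : u ≠ w) (n : ℕ) :
    ∀ x, G.toSimpleGraph.Reachable u x → x ≠ w → G.toSimpleGraph.dist u x ≤ n →
      n ≤ G.toSimpleGraph.dist u w →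
      Relation.ReflTransGen (fun a b => a ∈ S ∧ b ∈ S ∧ ∃ e, G.ends e = s(a, b)) x u := by
  induction n with
  | zero =>
    intro x hx _ hd _
    rw [(hx.dist_eq_zero_iff).mp (Nat.le_zero.mp hd)]
  | succ n ih =>
    intro x hx hxw hd hn
    obtain ⟨p, hp⟩ := hx.symm.exists_walk_length_eq_dist
    cases p with
    | nil => exact Relation.ReflTransGen.refl
    | @cons _ y _ hxy q =>
      have hdy : G.toSimpleGraph.dist u y ≤ n := by
        rw [SimpleGraph.dist_comm] at hp
        have := SimpleGraph.dist_le q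
        rw [SimpleGraph.dist_comm] at this
        rw [SimpleGraph.Walk.length_cons] at hp
        omega
      have hyw : y ≠ w := by
        rintro rfl
        omega
      have hy : G.toSimpleGraph.Reachable u y := q.reachable.symm
      exact Relation.ReflTransGen.head ⟨hS x hx hxw, hS y hy hyw, hxy.2⟩
        (ih y hy hyw hdy (by omega))

/-- Making `w` a sink only affects the edges at `w`. -/
theorem Orientation.exists_sink [Fintype E] (D : G.Orientation) (w : V) :
    ∃ D' : G.Orientation, (∀ e, D'.tail e ≠ D.tail e → w ∈ G.ends e) ∧ D'.outDeg w = 0 := by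
  refine ⟨⟨fun e => if D.tail e = w then D.head e else D.tail e,
    fun e => if D.tail e = w then D.tail e else D.head e, fun e => ?_⟩, fun e he => ?_, ?_⟩
  · split_ifs
    · exact D.reverse.consistent e
    · exact D.consistent e
  · refine (D.mem_ends_iff e w).mpr (Or.inl (by_contra fun h => he ?_))
    simp only [if_neg h]
  · refine Finset.card_eq_zero.mpr (Finset.filter_eq_empty_iff.mpr fun e _ => ?_)
    dsimp only
    split_ifs with h
    · exact fun h' => D.tail_ne_head e (h.trans h'.symm)
    · exact h

/-- A nontrivial component can be reoriented so that each out-degree in it is odd or zero. -/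
theorem Orientation.exists_odd_or_zero [Fintype V] [Fintype E] (D : G.Orientation) {u : V}
    (hu : ∃ e, u ∈ G.ends e) : ∃ D' : G.Orientation,
      (∀ e, D'.tail e ≠ D.tail e → ∀ a ∈ G.ends e, G.toSimpleGraph.Reachable u a) ∧
      ∀ x, G.toSimpleGraph.Reachable u x → D'.outDeg x % 2 = 1 ∨ D'.outDeg x = 0 := by
  let C := Finset.univ.filter fun x => G.toSimpleGraph.Reachable u x
  have hC : ∀ x, x ∈ C ↔ G.toSimpleGraph.Reachable u x := fun x => by simp [C]
  have huC : u ∈ C := (hC u).mpr (SimpleGraph.Reachable.refl u)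
  obtain ⟨w, hwC, hw⟩ := C.exists_max_image (fun x => G.toSimpleGraph.dist u x) ⟨u, huC⟩
  have huw : u ≠ w := by
    rintro rfl
    obtain ⟨e, he⟩ := hu
    obtain ⟨v, hv, hvu⟩ : ∃ v ∈ G.ends e, v ≠ u := by
      obtain h | h := (D.mem_ends_iff e u).mp he
      · exact ⟨D.head e, (D.mem_ends_iff e _).mpr (Or.inr rfl), h ▸ (D.tail_ne_head e).symm⟩
      · exact ⟨D.tail e, (D.mem_ends_iff e _).mpr (Or.inl rfl), h ▸ D.tail_ne_head e⟩
    have hr := reachable_of_mem_ends he hv (SimpleGraph.Reachable.refl u)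
    have := hw v ((hC v).mpr hr)
    rw [SimpleGraph.dist_self] at this
    exact hvu ((hr.dist_eq_zero_iff).mp (Nat.le_zero.mp this)).symm
  have hS : ∀ x, G.toSimpleGraph.Reachable u x → x ≠ w →
      x ∈ {x | G.toSimpleGraph.Reachable u x ∧ x ≠ w} := fun x h1 h2 => ⟨h1, h2⟩
  have hconn : ∀ x ∈ {x | G.toSimpleGraph.Reachable u x ∧ x ≠ w}, Relation.ReflTransGen
      (fun a b => a ∈ {x | G.toSimpleGraph.Reachable u x ∧ x ≠ w} ∧
        b ∈ {x | G.toSimpleGraph.Reachable u x ∧ x ≠ w} ∧ ∃ e, G.ends e = s(a, b)) x u :=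
    fun x hx => reflTransGen_of_dist_le hS huw _ x hx.1 hx.2 (hw x ((hC x).mpr hx.1)) le_rfl
  have hsum : ∀ D' : G.Orientation, ∑ x ∈ C, D'.outDeg x = ∑ x ∈ C, D.outDeg x := by
    intro D'
    rw [D'.sum_outDeg, D.sum_outDeg]
    congr 1
    ext e
    simp only [Finset.mem_filter, Finset.mem_univ, true_and, hC]
    have h1 := (D'.mem_ends_iff e _).mpr (Or.inl rfl)
    have h2 := (D.mem_ends_iff e _).mpr (Or.inl rfl)
    exact ⟨reachable_of_mem_ends h1 h2, reachable_of_mem_ends h2 h1⟩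
  obtain ⟨D₁, h1, h1'⟩ := D.exists_odd_on {x | G.toSimpleGraph.Reachable u x} u
    fun x hx => reflTransGen_of_reachable hx
  by_cases hu1 : D₁.outDeg u % 2 = 1
  · refine ⟨D₁, h1, fun x hx => Or.inl ?_⟩
    by_cases hxu : x = u
    · exact hxu ▸ hu1
    · exact h1' x hx hxu
  obtain ⟨D₂, h2, h2'⟩ := D.exists_sink w
  obtain ⟨D₃, h3, h3'⟩ := D₂.exists_odd_on {x | G.toSimpleGraph.Reachable u x ∧ x ≠ w} u hconn
  have hw3 : D₃.outDeg w = 0 := (outDeg_eq_of_unchanged h3 fun h => h.2 rfl).trans h2'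
  have hu3 : D₃.outDeg u % 2 = 1 := by
    by_contra hu3
    have heven : 2 ∣ ∑ x ∈ C, (D₁.outDeg x + D₃.outDeg x) := by
      rw [Finset.sum_add_distrib, hsum D₁, hsum D₃]
      omega
    rw [← Finset.add_sum_erase _ _ hwC] at heven
    have hrest : 2 ∣ ∑ x ∈ C.erase w, (D₁.outDeg x + D₃.outDeg x) := by
      refine Finset.dvd_sum fun x hx => ?_
      obtain ⟨hxw, hxC⟩ := Finset.mem_erase.mp hx
      by_cases hxu : x = u
      · subst hxu
        omega
      · have a := h1' x ((hC x).mp hxC) hxu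
        have b := h3' x ⟨(hC x).mp hxC, hxw⟩ hxu
        omega
    have a := h1' w ((hC w).mp hwC) huw.symm
    omega
  refine ⟨D₃, fun e he a ha => ?_, fun x hx => ?_⟩
  · by_cases h : D₃.tail e = D₂.tail e
    · exact reachable_of_mem_ends (h2 e (h ▸ he)) ha ((hC w).mp hwC)
    · exact (h3 e h a ha).1
  · by_cases hxw : x = w
    · exact Or.inr (hxw ▸ hw3)
    · by_cases hxu : x = u
      · exact Or.inl (hxu ▸ hu3)
      · exact Or.inl (h3' x ⟨hx, hxw⟩ hxu)

theorem exists_outDeg_ne_two_four [Fintype V] [Fintype E] (hreg : ∀ v, G.deg v = 5) :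
    ∃ D : G.Orientation, ∀ v, D.outDeg v ≠ 2 ∧ D.outDeg v ≠ 4 := by
  obtain ⟨D₀⟩ := G.exists_orientation
  obtain ⟨D, -, hmin⟩ := exists_minimal_measure (fun _ : G.Orientation => True)
    (fun D => (Finset.univ.filter fun v => D.outDeg v = 2 ∨ D.outDeg v = 4).card) ⟨D₀, trivial⟩
  refine ⟨D, fun u => not_or.mp fun hu => ?_⟩
  have hue : ∃ e, u ∈ G.ends e := by
    by_contra! h
    have h5 := hreg u
    rw [deg, Finset.card_eq_zero.mpr (Finset.filter_eq_empty_iff.mpr fun e _ => h e)] at h5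
    omega
  obtain ⟨D', h1, h2⟩ := D.exists_odd_or_zero hue
  have hgood : ∀ x, G.toSimpleGraph.Reachable u x → ¬ (D'.outDeg x = 2 ∨ D'.outDeg x = 4) := by
    intro x hx
    have := h2 x hx
    omega
  refine absurd (hmin D' trivial) (not_le.mpr (Finset.card_lt_card ?_))
  rw [Finset.ssubset_iff_of_subset]
  · exact ⟨u, by simpa using hu, by simpa using hgood u (SimpleGraph.Reachable.refl u)⟩
  · intro x
    simp only [Finset.mem_filter, Finset.mem_univ, true_and]
    intro hx
    by_cases hr : G.toSimpleGraph.Reachable u x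
    · exact absurd hx (hgood x hr)
    · rwa [← Orientation.outDeg_eq_of_unchanged (S := {x | G.toSimpleGraph.Reachable u x}) h1 hr]

theorem exists_outDeg_eq_two_or_three [Fintype V] [Fintype E] (hreg : ∀ v, G.deg v = 5) :
    ∃ D : G.Orientation, ∀ v, D.outDeg v = 2 ∨ D.outDeg v = 3 := by
  obtain ⟨D, hD⟩ := G.exists_balanced
  refine ⟨D, fun v => ?_⟩
  have a := D.outDeg_add_inDeg v
  rw [hreg] at a
  have b := hD v
  omega

/-- Forbidding `a` and `b` is equivalent, by reversing all edges, to forbidding `5 - a` and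
`5 - b`. -/
theorem exists_outDeg_ne_of_reverse [Fintype E] (hreg : ∀ v, G.deg v = 5) {a b c d : ℕ}
    (hac : a + c = 5) (hbd : b + d = 5)
    (h : ∃ D : G.Orientation, ∀ v, D.outDeg v ≠ a ∧ D.outDeg v ≠ b) :
    ∃ D : G.Orientation, ∀ v, D.outDeg v ≠ c ∧ D.outDeg v ≠ d := by
  obtain ⟨D, hD⟩ := h
  refine ⟨D.reverse, fun v => ?_⟩
  have h1 := D.outDeg_add_inDeg v
  rw [hreg] at h1
  have h2 := hD v
  have h3 : D.reverse.outDeg v = D.inDeg v := rfl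
  omega

theorem exists_outDeg_ne_two [Fintype V] [Fintype E] (hreg : ∀ v, G.deg v = 5) {b : ℕ}
    (hb : b ≤ 5) : ∃ D : G.Orientation, ∀ v, D.outDeg v ≠ 2 ∧ D.outDeg v ≠ b := by
  obtain rfl | rfl | rfl | rfl | rfl | rfl : b = 0 ∨ b = 1 ∨ b = 2 ∨ b = 3 ∨ b = 4 ∨ b = 5 := by
    omega
  · exact exists_outDeg_ne_of_reverse hreg rfl rfl (exists_outDeg_ne_three_five hreg)
  · exact (exists_outDeg_ne_one_two hreg).imp fun D h v => (h v).symm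
  · exact (exists_outDeg_ne_two_three hreg).imp fun D h v => ⟨(h v).1, (h v).1⟩
  · exact exists_outDeg_ne_two_three hreg
  · exact exists_outDeg_ne_two_four hreg
  · exact exists_outDeg_ne_two_five hreg

theorem exists_outDeg_ne_pair [Fintype V] [Fintype E] (hreg : ∀ v, G.deg v = 5) {a b : ℕ}
    (ha : a ≤ 5) (hb : b ≤ 5) :
    ∃ D : G.Orientation, ∀ v, D.outDeg v ≠ a ∧ D.outDeg v ≠ b := by
  have h3 : ∀ {b : ℕ}, b ≤ 5 → ∃ D : G.Orientation, ∀ v, D.outDeg v ≠ 3 ∧ D.outDeg v ≠ b :=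
    fun {b} hb => exists_outDeg_ne_of_reverse hreg rfl (by omega)
      (exists_outDeg_ne_two hreg (b := 5 - b) (by omega))
  by_cases ha2 : a = 2
  · exact ha2 ▸ exists_outDeg_ne_two hreg hb
  by_cases ha3 : a = 3
  · exact ha3 ▸ h3 hb
  by_cases hb2 : b = 2
  · exact hb2 ▸ (exists_outDeg_ne_two hreg ha).imp fun D h v => (h v).symm
  by_cases hb3 : b = 3
  · exact hb3 ▸ (h3 ha).imp fun D h v => (h v).symm
  refine (exists_outDeg_eq_two_or_three hreg).imp fun D h v => ?_
  have := h v
  omega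

theorem finite_of_deg_pos [Fintype E] (h : ∀ v, 0 < G.deg v) : Finite V := by
  obtain ⟨D⟩ := G.exists_orientation
  refine Finite.of_surjective (Sum.elim D.tail D.head) fun v => ?_
  obtain ⟨e, he⟩ := Finset.card_pos.mp (h v)
  obtain he | he := (D.mem_ends_iff e v).mp (Finset.mem_filter.mp he).2
  · exact ⟨Sum.inl e, he⟩
  · exact ⟨Sum.inr e, he⟩

end Multigraph

/-- every 5-regular graph and `F ⊆ {0,…,5}` with `|F| ≤ 2` admits an
`F`-avoiding orientation. -/
theorem stmt17 {V E : Type} [Fintype E] (G : Multigraph V E)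
    (hreg : ∀ v, G.deg v = 5)
    (F : Finset ℕ) (hFsub : F ⊆ Finset.range 6) (hF : F.card ≤ 2) :
    ∃ D : G.Orientation, ∀ v, D.outDeg v ∉ F := by
  have := Multigraph.finite_of_deg_pos (G := G) fun v => by rw [hreg]; norm_num
  have := Fintype.ofFinite V
  obtain ⟨T, hFT, hT, hcard⟩ := Finset.exists_subsuperset_card_eq hFsub hF (by simp)
  obtain ⟨a, b, -, rfl⟩ := Finset.card_eq_two.mp hcard
  have ha := Finset.mem_range.mp (hT (Finset.mem_insert_self a {b}))
  have hb := Finset.mem_range.mp (hT (Finset.mem_insert_of_mem (Finset.mem_singleton_self b)))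
  obtain ⟨D, hD⟩ := Multigraph.exists_outDeg_ne_pair hreg (Nat.le_of_lt_succ ha)
    (Nat.le_of_lt_succ hb)
  refine ⟨D, fun v hv => ?_⟩
  have h := hFT hv
  rw [Finset.mem_insert, Finset.mem_singleton] at h
  exact h.elim (hD v).1 (hD v).2
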